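/- arXiv:1601.05297 — 5 statements merged into one kernel-verified Lean document; each statement's English description precedes it below -/
import Mathlib

section
/- Let T > 0 and let h : ℝ → ℝ be square-integrable on (0,T), and set λ(t) = ∫₀^t h(s) ds for t ∈ [0,T]. Then the supremum, over all finite partitions 0 = t₀ < t₁ < ⋯ < t_k = T, of the sums Σ_{j=1}^k (λ(t_j) − λ(t_{j−1}))²/(t_j − t_{j−1}), is equal to ∫₀^T h(s)² ds, i.e. to twice the Dirichlet energy I_T(λ). -/
open MeasureTheory Filter Set

section

variable {f g : ℝ → ℝ} {a b c ε : ℝ}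

lemma intervalIntegral_sub_const_sq (hf : IntervalIntegrable f volume a b)
    (hf2 : IntervalIntegrable (fun s => f s ^ 2) volume a b) (c : ℝ) :
    ∫ s in a..b, (f s - c) ^ 2 =
      (∫ s in a..b, f s ^ 2) - 2 * c * (∫ s in a..b, f s) + c ^ 2 * (b - a) := by
  have h : ∀ s, (f s - c) ^ 2 = f s ^ 2 - 2 * c * f s + c ^ 2 := fun s => by ring
  simp only [h]
  rw [intervalIntegral.integral_add (hf2.sub (hf.const_mul _)) (by simp),
    intervalIntegral.integral_sub hf2 (hf.const_mul _), intervalIntegral.integral_const_mul,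
    intervalIntegral.integral_const, smul_eq_mul]
  ring

lemma sq_intervalIntegral_div_le (hab : a < b) (hf : IntervalIntegrable f volume a b)
    (hf2 : IntervalIntegrable (fun s => f s ^ 2) volume a b) :
    (∫ s in a..b, f s) ^ 2 / (b - a) ≤ ∫ s in a..b, f s ^ 2 := by
  have hpos : 0 < b - a := sub_pos.2 hab
  have h0 : 0 ≤ ∫ s in a..b, (f s - (∫ s in a..b, f s) / (b - a)) ^ 2 :=
    intervalIntegral.integral_nonneg hab.le fun _ _ => sq_nonneg _
  rw [intervalIntegral_sub_const_sq hf hf2] at h0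
  have h1 : (∫ s in a..b, f s ^ 2) - 2 * ((∫ s in a..b, f s) / (b - a)) * (∫ s in a..b, f s)
      + ((∫ s in a..b, f s) / (b - a)) ^ 2 * (b - a)
      = (∫ s in a..b, f s ^ 2) - (∫ s in a..b, f s) ^ 2 / (b - a) := by
    field_simp
    ring
  linarith

lemma le_sq_intervalIntegral_div (hab : a < b) (hf : IntervalIntegrable f volume a b)
    (hf2 : IntervalIntegrable (fun s => f s ^ 2) volume a b)
    (hfg : IntervalIntegrable (fun s => (f s - g s) ^ 2) volume a b)
    (hgc : ∀ s ∈ Icc a b, |g s - c| ≤ ε) :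
    (∫ s in a..b, f s ^ 2) - 2 * (∫ s in a..b, (f s - g s) ^ 2) - 2 * ε ^ 2 * (b - a) ≤
      (∫ s in a..b, f s) ^ 2 / (b - a) := by
  have hpos : 0 < b - a := sub_pos.2 hab
  have hfc : IntervalIntegrable (fun s => (f s - c) ^ 2) volume a b := by
    have h : (fun s => (f s - c) ^ 2) = fun s => f s ^ 2 - 2 * c * f s + c ^ 2 := by
      ext s; ring
    rw [h]
    exact (hf2.sub (hf.const_mul _)).add (by simp)
  have h1 : ∫ s in a..b, (f s - c) ^ 2 ≤ ∫ s in a..b, (2 * (f s - g s) ^ 2 + 2 * ε ^ 2) := by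
    refine intervalIntegral.integral_mono_on hab.le hfc
      ((hfg.const_mul _).add (by simp)) fun s hs => ?_
    have h2 : (g s - c) ^ 2 ≤ ε ^ 2 := sq_le_sq' (abs_le.1 (hgc s hs)).1 (abs_le.1 (hgc s hs)).2
    nlinarith [sq_nonneg ((f s - g s) - (g s - c))]
  rw [intervalIntegral_sub_const_sq hf hf2,
    intervalIntegral.integral_add (hfg.const_mul _) (by simp),
    intervalIntegral.integral_const_mul, intervalIntegral.integral_const, smul_eq_mul] at h1
  have h3 : 2 * c * (∫ s in a..b, f s) - c ^ 2 * (b - a) ≤ (∫ s in a..b, f s) ^ 2 / (b - a) := by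
    rw [le_div_iff₀ hpos]
    nlinarith [sq_nonneg ((∫ s in a..b, f s) - c * (b - a))]
  linarith

end

/-- The supremum over finite partitions `0 = t₀ < t₁ < ⋯ < t_k = T` of the sums
`Σ (λ(t_j) − λ(t_{j−1}))²/(t_j − t_{j−1})` equals `∫₀^T h(s)² ds`, where
`λ(t) = ∫₀^t h(s) ds` and `h` is square-integrable on `(0,T)`. -/
theorem energy_eq_sup_partition_sums
    (T : ℝ) (hT : 0 < T) (h : ℝ → ℝ) (hmeas : Measurable h)
    (hL2 : IntegrableOn (fun s => h s ^ 2) (Set.Ioc 0 T))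
    (lam : ℝ → ℝ) (hlam : ∀ t, lam t = ∫ s in (0:ℝ)..t, h s) :
    sSup {S : ℝ | ∃ (k : ℕ) (t : ℕ → ℝ), 0 < k ∧ t 0 = 0 ∧ t k = T ∧
        (∀ i < k, t i < t (i + 1)) ∧
        S = ∑ j ∈ Finset.range k,
              (lam (t (j + 1)) - lam (t j)) ^ 2 / (t (j + 1) - t j)} =
      ∫ s in (0:ℝ)..T, (h s) ^ 2 := by
  have hmem : MemLp h 2 (volume.restrict (Ioc 0 T)) :=
    (memLp_two_iff_integrable_sq hmeas.aestronglyMeasurable).2 hL2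
  have hI {f : ℝ → ℝ} (hf : IntegrableOn f (Ioc 0 T)) {a b : ℝ} (ha : a ∈ Icc 0 T)
      (hb : b ∈ Icc 0 T) : IntervalIntegrable f volume a b := by
    refine ((intervalIntegrable_iff_integrableOn_Ioc_of_le hT.le).2 hf).mono_set ?_
    rw [uIcc_of_le hT.le]
    exact uIcc_subset_Icc ha hb
  have hL1 : IntegrableOn h (Ioc 0 T) := hmem.integrable one_le_two
  have hdiff {a b : ℝ} (ha : a ∈ Icc 0 T) (hb : b ∈ Icc 0 T) :
      lam b - lam a = ∫ s in a..b, h s := by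
    rw [hlam, hlam]
    exact intervalIntegral.integral_interval_sub_left (hI hL1 ⟨le_rfl, hT.le⟩ hb)
      (hI hL1 ⟨le_rfl, hT.le⟩ ha)
  have htmem {k : ℕ} {t : ℕ → ℝ} (h0 : t 0 = 0) (hk : t k = T)
      (hlt : ∀ i < k, t i < t (i + 1)) : ∀ i ≤ k, t i ∈ Icc 0 T := by
    have hmono : MonotoneOn t (Icc 0 k) := by
      refine monotoneOn_of_le_add_one ordConnected_Icc fun i _ _ hi => ?_
      exact (hlt i hi.2).le
    intro i hi
    rw [← h0, ← hk]
    exact ⟨hmono ⟨le_rfl, zero_le⟩ ⟨zero_le, hi⟩ zero_le,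
      hmono ⟨zero_le, hi⟩ ⟨zero_le, le_rfl⟩ hi⟩
  have hsum {f : ℝ → ℝ} (hf : IntegrableOn f (Ioc 0 T)) {k : ℕ} {t : ℕ → ℝ} (h0 : t 0 = 0)
      (hk : t k = T) (hlt : ∀ i < k, t i < t (i + 1)) :
      ∑ j ∈ Finset.range k, ∫ s in t j..t (j + 1), f s = ∫ s in (0:ℝ)..T, f s := by
    rw [intervalIntegral.sum_integral_adjacent_intervals fun i hi =>
      hI hf (htmem h0 hk hlt i hi.le) (htmem h0 hk hlt (i + 1) hi), h0, hk]
  apply csSup_eq_of_forall_le_of_forall_lt_exists_gt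
  · refine ⟨_, 1, fun i => i * T, one_pos, by simp, by simp, fun i _ => ?_, rfl⟩
    push_cast
    linarith
  · rintro S ⟨k, t, -, h0, hk, hlt, rfl⟩
    rw [← hsum hL2 h0 hk hlt]
    refine Finset.sum_le_sum fun j hj => ?_
    have hj := Finset.mem_range.1 hj
    have h1 := htmem h0 hk hlt j hj.le
    have h2 := htmem h0 hk hlt (j + 1) hj
    rw [hdiff h1 h2]
    exact sq_intervalIntegral_div_le (hlt j hj) (hI hL1 h1 h2) (hI hL2 h1 h2)
  · intro w hw
    set η : ℝ := (∫ s in (0:ℝ)..T, h s ^ 2) - w with hη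
    have hηpos : 0 < η := sub_pos.2 hw
    obtain ⟨g, hgsupp, hgint, hgcont, hgmem⟩ :=
      MemLp.exists_hasCompactSupport_integral_rpow_sub_le (p := 2) two_pos
        (by simpa using hmem) (ε := η / 8) (by positivity)
    have hsub : IntegrableOn (fun s => (h s - g s) ^ 2) (Ioc 0 T) :=
      (hmem.sub (by simpa using hgmem)).integrable_sq
    have hgint' : ∫ s in (0:ℝ)..T, (h s - g s) ^ 2 ≤ η / 8 := by
      rw [intervalIntegral.integral_of_le hT.le]
      simpa using hgint
    obtain ⟨ε, hε, hεT⟩ : ∃ ε > 0, 2 * ε ^ 2 * T ≤ η / 4 := by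
      refine ⟨√(η / (8 * T)), by positivity, ?_⟩
      rw [Real.sq_sqrt (by positivity)]
      apply le_of_eq
      field_simp
      norm_num
    obtain ⟨δ, hδ, hgδ⟩ := Metric.uniformContinuous_iff.1
      (hgsupp.uniformContinuous_of_continuous hgcont) ε hε
    obtain ⟨n, hn⟩ := exists_nat_gt (T / δ)
    have hnpos : (0:ℝ) < n := lt_trans (by positivity) hn
    let t : ℕ → ℝ := fun i => i * (T / n)
    have h0 : t 0 = 0 := by simp [t]
    have hk : t n = T := by simp only [t]; field_simp
    have hstep : ∀ i, t (i + 1) = t i + T / n := fun i => by simp only [t]; push_cast; ring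
    have hlt : ∀ i < n, t i < t (i + 1) := fun i _ => by
      rw [hstep]; exact lt_add_of_pos_right _ (by positivity)
    have hTn : T / n < δ := by
      rw [div_lt_iff₀ hnpos]; rwa [div_lt_iff₀' hδ] at hn
    refine ⟨_, ⟨n, t, by exact_mod_cast hnpos, h0, hk, hlt, rfl⟩, ?_⟩
    have hle : (∫ s in (0:ℝ)..T, h s ^ 2) - 2 * (∫ s in (0:ℝ)..T, (h s - g s) ^ 2)
        - 2 * ε ^ 2 * T ≤ ∑ j ∈ Finset.range n,
          (lam (t (j + 1)) - lam (t j)) ^ 2 / (t (j + 1) - t j) := by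
      have hT' : 2 * ε ^ 2 * T = ∑ j ∈ Finset.range n, 2 * ε ^ 2 * (t (j + 1) - t j) := by
        rw [← Finset.mul_sum, Finset.sum_range_sub, h0, hk, sub_zero]
      rw [hT', ← hsum hL2 h0 hk hlt, ← hsum hsub h0 hk hlt, Finset.mul_sum,
        ← Finset.sum_sub_distrib, ← Finset.sum_sub_distrib]
      refine Finset.sum_le_sum fun j hj => ?_
      have hj := Finset.mem_range.1 hj
      have h1 := htmem h0 hk hlt j hj.le
      have h2 := htmem h0 hk hlt (j + 1) hj
      rw [hdiff h1 h2]
      refine le_sq_intervalIntegral_div (c := g (t j)) (hlt j hj) (hI hL1 h1 h2) (hI hL2 h1 h2)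
        (hI hsub h1 h2) fun s hs => ?_
      have := hstep j
      refine (hgδ (a := s) (b := t j) ?_).le
      rw [Real.dist_eq, abs_of_nonneg (by linarith [hs.1])]
      linarith [hs.2]
    linarith
end

section
/- Let T > 0, let λ : [0,T] → ℝ be continuous with λ(0) = 0, and let C ≥ 0. Suppose that for every finite partition 0 = t₀ < t₁ < ⋯ < t_k = T one has Σ_{j=1}^k (λ(t_j) − λ(t_{j−1}))²/(t_j − t_{j−1}) ≤ C. Then there exists a measurable h : ℝ → ℝ, square-integrable on (0,T), such that λ(t) = ∫₀^t h(s) ds for all t ∈ [0,T] and ∫₀^T h(s)² ds ≤ C; in particular λ is absolutely continuous with Dirichlet energy I_T(λ) ≤ C/2. -/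
open MeasureTheory Filter Set

/-- The sums `Σ (f(t_{j+1}) − f(t_j))²/(t_{j+1} − t_j)` over the finite partitions of `[a, x]`.
For `x = a` the only partition is the one with a single point. -/
def quadraticPartitionSums (f : ℝ → ℝ) (a x : ℝ) : Set ℝ :=
  {v | ∃ (k : ℕ) (t : ℕ → ℝ), t 0 = a ∧ t k = x ∧ (∀ i < k, t i < t (i + 1)) ∧
    v = ∑ j ∈ Finset.range k, (f (t (j + 1)) - f (t j)) ^ 2 / (t (j + 1) - t j)}

theorem zero_mem_quadraticPartitionSums_self (f : ℝ → ℝ) (a : ℝ) :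
    0 ∈ quadraticPartitionSums f a a :=
  ⟨0, fun _ => a, rfl, rfl, by simp, by simp⟩

theorem add_mem_quadraticPartitionSums {f : ℝ → ℝ} {a x y v : ℝ} (hxy : x < y)
    (hv : v ∈ quadraticPartitionSums f a x) :
    v + (f y - f x) ^ 2 / (y - x) ∈ quadraticPartitionSums f a y := by
  obtain ⟨k, t, h0, hk, ht, rfl⟩ := hv
  refine ⟨k + 1, fun i => if i ≤ k then t i else y, by simp [h0], by simp, ?_, ?_⟩
  · intro i hi
    rcases (Nat.lt_succ_iff.mp hi).eq_or_lt with rfl | h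
    · simpa [hk] using hxy
    · simpa [h.le, Nat.succ_le_of_lt h] using ht i h
  · rw [Finset.sum_range_succ]
    congr 1
    · refine Finset.sum_congr rfl fun j hj => ?_
      have hj' := Finset.mem_range.mp hj
      simp [hj'.le, Nat.succ_le_of_lt hj']
    · simp [hk]

theorem quadraticPartitionSums_nonempty (f : ℝ → ℝ) {a x : ℝ} (hax : a ≤ x) :
    (quadraticPartitionSums f a x).Nonempty := by
  rcases hax.eq_or_lt with rfl | h
  · exact ⟨0, zero_mem_quadraticPartitionSums_self f a⟩
  · exact ⟨_, add_mem_quadraticPartitionSums h (zero_mem_quadraticPartitionSums_self f a)⟩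

/-- If the partition sums of `f` on `[a, b]` are bounded by `C`, then the squared increments of `f`
are controlled by the increments of a monotone function whose total increment is at most `C`. -/
theorem exists_monotoneOn_sq_sub_le {f : ℝ → ℝ} {a b C : ℝ} (hab : a ≤ b)
    (hC : ∀ v ∈ quadraticPartitionSums f a b, v ≤ C) :
    ∃ E : ℝ → ℝ, MonotoneOn E (Icc a b) ∧ E b - E a ≤ C ∧
      ∀ x ∈ Icc a b, ∀ y ∈ Icc a b, x ≤ y → (f y - f x) ^ 2 ≤ (y - x) * (E y - E x) := by
  have hbdd : ∀ x ∈ Icc a b, BddAbove (quadraticPartitionSums f a x) := by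
    rintro x ⟨-, hxb⟩
    refine ⟨C, fun v hv => ?_⟩
    rcases hxb.eq_or_lt with rfl | h
    · exact hC v hv
    · have : 0 ≤ (f b - f x) ^ 2 / (b - x) := div_nonneg (sq_nonneg _) (sub_nonneg.mpr h.le)
      linarith [hC _ (add_mem_quadraticPartitionSums h hv)]
  let E : ℝ → ℝ := fun x => sSup (quadraticPartitionSums f a x)
  have key : ∀ x ∈ Icc a b, ∀ y ∈ Icc a b, x < y →
      (f y - f x) ^ 2 / (y - x) ≤ E y - E x := by
    intro x hx y hy hxy
    have : E x ≤ E y - (f y - f x) ^ 2 / (y - x) :=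
      csSup_le (quadraticPartitionSums_nonempty f hx.1) fun v hv =>
        le_sub_iff_add_le.mpr (le_csSup (hbdd y hy) (add_mem_quadraticPartitionSums hxy hv))
    linarith
  refine ⟨E, fun x hx y hy hxy => ?_, ?_, fun x hx y hy hxy => ?_⟩
  · rcases hxy.eq_or_lt with rfl | h
    · exact le_rfl
    · have : 0 ≤ (f y - f x) ^ 2 / (y - x) := div_nonneg (sq_nonneg _) (sub_nonneg.mpr hxy)
      linarith [key x hx y hy h]
  · have h1 : 0 ≤ E a :=
      le_csSup (hbdd a ⟨le_rfl, hab⟩) (zero_mem_quadraticPartitionSums_self f a)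
    have h2 : E b ≤ C := csSup_le (quadraticPartitionSums_nonempty f hab) hC
    linarith
  · rcases hxy.eq_or_lt with rfl | h
    · simp
    · have := key x hx y hy h
      rwa [div_le_iff₀ (sub_pos.mpr h), mul_comm] at this

/-- The increments of a monotone function over disjoint intervals add up to at most its total
increment. -/
theorem MonotoneOn.sum_dist_le_of_pairwiseDisjoint {ι : Type*} {f : ℝ → ℝ} {a b : ℝ} (hab : a ≤ b)
    (hf : MonotoneOn f (Icc a b)) (s : Finset ι) (u v : ι → ℝ)
    (hu : ∀ i ∈ s, u i ∈ Icc a b) (hv : ∀ i ∈ s, v i ∈ Icc a b)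
    (hd : (s : Set ι).PairwiseDisjoint fun i => uIoc (u i) (v i)) :
    ∑ i ∈ s, dist (f (u i)) (f (v i)) ≤ f b - f a := by
  classical
  suffices h : ∀ y ∈ Icc a b, (∀ i ∈ s, u i ≠ v i → max (u i) (v i) ≤ y) →
      ∑ i ∈ s, dist (f (u i)) (f (v i)) ≤ f y - f a from
    h b ⟨hab, le_rfl⟩ fun i hi _ => max_le (hu i hi).2 (hv i hi).2
  induction s using Finset.induction_on_max_value (fun i => max (u i) (v i)) with
  | empty =>
    intro y hy _
    simpa using hf ⟨le_rfl, hab⟩ hy hy.1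
  | insert i s his hmax ih =>
    intro y hy hle
    have ih := ih (fun j hj => hu j (Finset.mem_insert_of_mem hj))
      (fun j hj => hv j (Finset.mem_insert_of_mem hj)) (hd.subset (by simp))
    rw [Finset.sum_insert his]
    by_cases hi : u i = v i
    · simpa [hi] using ih y hy fun j hj => hle j (Finset.mem_insert_of_mem hj)
    have hui := hu i (Finset.mem_insert_self i s)
    have hvi := hv i (Finset.mem_insert_self i s)
    have hmin : min (u i) (v i) ∈ Icc a b := ⟨le_min hui.1 hvi.1, min_le_of_left_le hui.2⟩
    have hmax' : max (u i) (v i) ∈ Icc a b := ⟨le_max_of_le_left hui.1, max_le hui.2 hvi.2⟩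
    have hsum := ih _ hmin fun j hj hne => by
      by_contra! hlt
      have hij : Disjoint (uIoc (u i) (v i)) (uIoc (u j) (v j)) :=
        hd (by simp) (by simp [hj]) (by rintro rfl; exact his hj)
      exact disjoint_left.mp hij ⟨hlt, hmax j hj⟩ ⟨min_lt_max.mpr hne, le_rfl⟩
    have hy' : f (max (u i) (v i)) ≤ f y :=
      hf hmax' hy (hle i (Finset.mem_insert_self i s) hi)
    have hdist : dist (f (u i)) (f (v i)) = f (max (u i) (v i)) - f (min (u i) (v i)) := by
      rcases le_total (u i) (v i) with h | h
      · rw [max_eq_right h, min_eq_left h, dist_comm, Real.dist_eq,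
          abs_of_nonneg (sub_nonneg.mpr (hf hui hvi h))]
      · rw [max_eq_left h, min_eq_right h, Real.dist_eq,
          abs_of_nonneg (sub_nonneg.mpr (hf hvi hui h))]
    linarith

theorem absolutelyContinuousOnInterval_of_sq_sub_le {f E : ℝ → ℝ} {a b : ℝ} (hab : a ≤ b)
    (hE : MonotoneOn E (Icc a b))
    (hfE : ∀ x ∈ Icc a b, ∀ y ∈ Icc a b, x ≤ y → (f y - f x) ^ 2 ≤ (y - x) * (E y - E x)) :
    AbsolutelyContinuousOnInterval f a b := by
  have hM : 0 ≤ E b - E a := sub_nonneg.mpr (hE ⟨le_rfl, hab⟩ ⟨hab, le_rfl⟩ hab)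
  have hsq : ∀ x ∈ Icc a b, ∀ y ∈ Icc a b,
      dist (f x) (f y) ^ 2 ≤ dist x y * dist (E x) (E y) := by
    have aux : ∀ x ∈ Icc a b, ∀ y ∈ Icc a b, x ≤ y →
        dist (f y) (f x) ^ 2 ≤ dist y x * dist (E y) (E x) := fun x hx y hy h => by
      rw [Real.dist_eq, Real.dist_eq, Real.dist_eq, sq_abs, abs_of_nonneg (sub_nonneg.mpr h),
        abs_of_nonneg (sub_nonneg.mpr (hE hx hy h))]
      exact hfE x hx y hy h
    intro x hx y hy
    rcases le_total x y with h | h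
    · simpa only [dist_comm] using aux x hx y hy h
    · exact aux y hy x hx h
  rw [absolutelyContinuousOnInterval_iff]
  intro ε hε
  refine ⟨ε ^ 2 / (E b - E a + 1), by positivity, fun I hI hlen => ?_⟩
  obtain ⟨hmem, hdisj⟩ := hI
  rw [uIcc_of_le hab] at hmem
  have hsum : ∑ i ∈ Finset.range I.1, dist (E (I.2 i).1) (E (I.2 i).2) ≤ E b - E a :=
    hE.sum_dist_le_of_pairwiseDisjoint hab _ _ _ (fun i hi => (hmem i hi).1)
      (fun i hi => (hmem i hi).2) hdisj
  have hcs := Finset.sum_sq_le_sum_mul_sum_of_sq_le_mul (Finset.range I.1)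
    (r := fun i => dist (f (I.2 i).1) (f (I.2 i).2))
    (f := fun i => dist (I.2 i).1 (I.2 i).2) (g := fun i => dist (E (I.2 i).1) (E (I.2 i).2))
    (fun _ _ => dist_nonneg) (fun _ _ => dist_nonneg)
    (fun i hi => hsq _ (hmem i hi).1 _ (hmem i hi).2)
  rw [lt_div_iff₀ (by positivity)] at hlen
  refine lt_of_pow_lt_pow_left₀ 2 hε.le (hcs.trans_lt (lt_of_le_of_lt ?_ hlen))
  exact mul_le_mul_of_nonneg_left (by linarith) (Finset.sum_nonneg fun _ _ => dist_nonneg)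

theorem sq_deriv_le_of_sq_sub_le {f E : ℝ → ℝ} {a b x : ℝ} (hx : x ∈ Ioo a b)
    (hfE : ∀ x ∈ Icc a b, ∀ y ∈ Icc a b, x ≤ y → (f y - f x) ^ 2 ≤ (y - x) * (E y - E x))
    (hf : DifferentiableAt ℝ f x) (hE : DifferentiableAt ℝ E x) :
    deriv f x ^ 2 ≤ deriv E x := by
  have hf' := (hasDerivAt_iff_tendsto_slope_left_right.mp hf.hasDerivAt).2.pow 2
  have hE' := (hasDerivAt_iff_tendsto_slope_left_right.mp hE.hasDerivAt).2
  refine le_of_tendsto_of_tendsto hf' hE' ?_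
  filter_upwards [Ioo_mem_nhdsGT hx.2] with y hy
  have hpos : 0 < y - x := sub_pos.mpr hy.1
  rw [slope_def_field, slope_def_field, div_pow, div_le_div_iff₀ (by positivity) hpos]
  nlinarith [hfE x ⟨hx.1.le, hx.2.le⟩ y ⟨(hx.1.trans hy.1).le, hy.2.le⟩ hy.1.le]

/-- If a continuous `λ : [0,T] → ℝ` with `λ(0) = 0` has all its partition sums
`Σ (λ(t_j) − λ(t_{j−1}))²/(t_j − t_{j−1})` bounded by `C`, then `λ` is absolutely
continuous with square-integrable derivative `h` and `∫₀^T h² ≤ C`. -/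
theorem abs_continuous_of_bounded_partition_sums
    (T : ℝ) (hT : 0 < T) (lam : ℝ → ℝ)
    (hcont : ContinuousOn lam (Set.Icc 0 T)) (h0 : lam 0 = 0)
    (C : ℝ) (hC : 0 ≤ C)
    (hpart : ∀ (k : ℕ) (t : ℕ → ℝ), 0 < k → t 0 = 0 → t k = T →
        (∀ i < k, t i < t (i + 1)) →
        ∑ j ∈ Finset.range k,
            (lam (t (j + 1)) - lam (t j)) ^ 2 / (t (j + 1) - t j) ≤ C) :
    ∃ h : ℝ → ℝ, Measurable h ∧
      IntegrableOn (fun s => h s ^ 2) (Set.Ioc 0 T) ∧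
      (∀ t ∈ Set.Icc (0:ℝ) T, lam t = ∫ s in (0:ℝ)..t, h s) ∧
      ∫ s in (0:ℝ)..T, (h s) ^ 2 ≤ C := by
  have hsums : ∀ v ∈ quadraticPartitionSums lam 0 T, v ≤ C := by
    rintro v ⟨k, t, ht0, htk, ht, rfl⟩
    refine hpart k t (Nat.pos_of_ne_zero ?_) ht0 htk ht
    rintro rfl
    linarith
  obtain ⟨E, hE, hEC, hlamE⟩ := exists_monotoneOn_sq_sub_le hT.le hsums
  have hE' : MonotoneOn E (uIcc 0 T) := by rwa [uIcc_of_le hT.le]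
  have hac := absolutelyContinuousOnInterval_of_sq_sub_le hT.le hE hlamE
  have hEint : IntervalIntegrable (deriv E) volume 0 T := hE'.intervalIntegrable_deriv
  have hle : ∀ᵐ x ∂volume.restrict (Ioc 0 T), deriv lam x ^ 2 ≤ deriv E x := by
    rw [ae_restrict_iff' measurableSet_Ioc]
    filter_upwards [hac.ae_differentiableAt, hE.ae_differentiableWithinAt_of_mem,
      compl_mem_ae_iff.mpr (measure_singleton T)] with x hx₁ hx₂ hxT hx
    have hx' : x ∈ Ioo 0 T := ⟨hx.1, lt_of_le_of_ne hx.2 hxT⟩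
    have hxI : x ∈ Icc 0 T := Ioo_subset_Icc_self hx'
    exact sq_deriv_le_of_sq_sub_le hx' hlamE (hx₁ (by rwa [uIcc_of_le hT.le]))
      ((hx₂ hxI).differentiableAt (Icc_mem_nhds hx'.1 hx'.2))
  have hEon : IntegrableOn (deriv E) (Ioc 0 T) :=
    (intervalIntegrable_iff_integrableOn_Ioc_of_le hT.le).mp hEint
  have hint : IntegrableOn (fun s => deriv lam s ^ 2) (Ioc 0 T) :=
    Integrable.mono' hEon ((measurable_deriv lam).pow_const 2).aestronglyMeasurable
      (hle.mono fun x hx => by rwa [Real.norm_of_nonneg (sq_nonneg _)])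
  refine ⟨deriv lam, measurable_deriv lam, hint, fun t ht => ?_, ?_⟩
  · have hsub : uIcc 0 t ⊆ uIcc 0 T := by
      rw [uIcc_of_le ht.1, uIcc_of_le hT.le]
      exact Icc_subset_Icc_right ht.2
    rw [(hac.mono hsub).integral_deriv_eq_sub, h0, sub_zero]
  · have hmem := hE'.intervalIntegral_deriv_mem_uIcc
    rw [uIcc_of_le (sub_nonneg.mpr (hE ⟨le_rfl, hT.le⟩ ⟨hT.le, le_rfl⟩ hT.le))] at hmem
    refine le_trans ?_ (hmem.2.trans hEC)
    rw [intervalIntegral.integral_of_le hT.le, intervalIntegral.integral_of_le hT.le]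
    exact integral_mono_ae hint hEon hle
end

section
/- (Lower semicontinuity of the Dirichlet energy.) Let T > 0 and for each n let hₙ : ℝ → ℝ be square-integrable on (0,T) with λₙ(t) = ∫₀^t hₙ(s) ds, and suppose (1/2)∫₀^T hₙ(s)² ds ≤ c for all n, for some constant c ≥ 0. If λₙ converges uniformly on [0,T] to a function λ, then there exists a measurable h : ℝ → ℝ, square-integrable on (0,T), such that λ(t) = ∫₀^t h(s) ds for all t ∈ [0,T] and (1/2)∫₀^T h(s)² ds ≤ liminf_{n→∞} (1/2)∫₀^T hₙ(s)² ds. -/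
open MeasureTheory Filter Set

open scoped Topology InnerProductSpace

/-- A bounded real sequence converges to its lower limit along some ultrafilter. -/
theorem exists_ultrafilter_tendsto_liminf {u : ℕ → ℝ} {a b : ℝ}
    (ha : ∀ n, a ≤ u n) (hb : ∀ n, u n ≤ b) :
    ∃ U : Ultrafilter ℕ, (U : Filter ℕ) ≤ atTop ∧ Tendsto u U (𝓝 (liminf u atTop)) := by
  have hbelow : IsBoundedUnder (· ≥ ·) atTop u := isBoundedUnder_of ⟨a, ha⟩
  have habove : IsBoundedUnder (· ≤ ·) atTop u := isBoundedUnder_of ⟨b, hb⟩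
  refine mapClusterPt_iff_ultrafilter.1 ?_
  rw [Metric.nhds_basis_ball.mapClusterPt_iff_frequently]
  intro ε hε
  have h₁ := frequently_lt_of_liminf_lt habove.isCoboundedUnder_ge
    (lt_add_of_pos_right (liminf u atTop) hε)
  have h₂ := eventually_lt_of_lt_liminf (sub_lt_self (liminf u atTop) hε) hbelow
  refine (h₁.and_eventually h₂).mono fun n hn => ?_
  rw [Metric.mem_ball, Real.dist_eq, abs_sub_lt_iff]
  constructor <;> linarith [hn.1, hn.2]

/-- A bounded family in a Hilbert space converges weakly along every ultrafilter. -/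
theorem Ultrafilter.exists_tendsto_inner {ι H : Type*} [NormedAddCommGroup H]
    [InnerProductSpace ℝ H] [CompleteSpace H] (U : Ultrafilter ι) {f : ι → H} {r : ℝ}
    (hf : ∀ i, ‖f i‖ ≤ r) :
    ∃ g : H, ∀ x, Tendsto (fun i => ⟪f i, x⟫_ℝ) U (𝓝 ⟪g, x⟫_ℝ) := by
  let F : ι → WeakDual ℝ H := fun i =>
    StrongDual.toWeakDual (InnerProductSpace.toDual ℝ H (f i))
  have hF : ∀ i, F i ∈ WeakDual.toStrongDual ⁻¹' Metric.closedBall (0 : StrongDual ℝ H) r := by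
    intro i
    simpa [F] using hf i
  obtain ⟨φ, -, hφ⟩ := (WeakDual.isCompact_closedBall (𝕜 := ℝ) (0 : StrongDual ℝ H) r)
    |>.ultrafilter_le_nhds (U.map F) (tendsto_principal.2 (Eventually.of_forall hF))
  refine ⟨(InnerProductSpace.toDual ℝ H).symm (WeakDual.toStrongDual φ), fun x => ?_⟩
  have := ((WeakDual.eval_continuous x).tendsto φ).comp (show Tendsto F U (𝓝 φ) from hφ)
  simpa [F, Function.comp_def] using this

/-- The squared norm is weakly lower semicontinuous. -/
theorem norm_sq_le_of_tendsto_inner {ι H : Type*} [NormedAddCommGroup H]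
    [InnerProductSpace ℝ H] {l : Filter ι} [l.NeBot] {f : ι → H} {g : H} {a : ℝ}
    (hf : Tendsto (fun i => ⟪f i, g⟫_ℝ) l (𝓝 ⟪g, g⟫_ℝ))
    (ha : Tendsto (fun i => ‖f i‖ ^ 2) l (𝓝 a)) : ‖g‖ ^ 2 ≤ a := by
  have := le_of_tendsto_of_tendsto (hf.const_mul 2) (ha.add_const (‖g‖ ^ 2))
    (Eventually.of_forall fun i => by
      nlinarith [real_inner_le_norm (f i) g, sq_nonneg (‖f i‖ - ‖g‖)])
  rw [real_inner_self_eq_norm_sq] at this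
  linarith

theorem L2.norm_sq_eq_integral_sq {α : Type*} [MeasurableSpace α] {μ : Measure α}
    (f : Lp ℝ 2 μ) : ‖f‖ ^ 2 = ∫ x, f x ^ 2 ∂μ := by
  rw [← real_inner_self_eq_norm_sq, L2.inner_def]
  simp [pow_two]

theorem L2.inner_indicatorConstLp_Ioc {T t : ℝ} (ht : t ∈ Icc 0 T)
    (f : Lp ℝ 2 (volume.restrict (Ioc 0 T))) :
    ⟪f, indicatorConstLp 2 measurableSet_Ioc
      (measure_ne_top (volume.restrict (Ioc 0 T)) (Ioc 0 t)) (1 : ℝ)⟫_ℝ = ∫ s in (0 : ℝ)..t, f s := by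
  rw [real_inner_comm, L2.inner_indicatorConstLp_one, Measure.restrict_restrict measurableSet_Ioc,
    inter_eq_self_of_subset_left (Ioc_subset_Ioc_right ht.2), intervalIntegral.integral_of_le ht.1]

/-- Lower semicontinuity of the Dirichlet energy: if `λₙ(t) = ∫₀^t hₙ` have energies
bounded by `c` and `λₙ → λ` uniformly on `[0,T]`, then `λ` is absolutely continuous
with derivative `h` and `(1/2)∫₀^T h² ≤ liminf (1/2)∫₀^T hₙ²`. -/
theorem energy_lowerSemicontinuous
    (T : ℝ) (hT : 0 < T) (c : ℝ) (hc : 0 ≤ c)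
    (hn : ℕ → ℝ → ℝ) (hmeas : ∀ n, Measurable (hn n))
    (hL2 : ∀ n, IntegrableOn (fun s => hn n s ^ 2) (Set.Ioc 0 T))
    (lamn : ℕ → ℝ → ℝ) (hlamn : ∀ n t, lamn n t = ∫ s in (0:ℝ)..t, hn n s)
    (hbound : ∀ n, (1/2 : ℝ) * ∫ s in (0:ℝ)..T, (hn n s) ^ 2 ≤ c)
    (lam : ℝ → ℝ)
    (hconv : TendstoUniformlyOn lamn lam Filter.atTop (Set.Icc 0 T)) :
    ∃ h : ℝ → ℝ, Measurable h ∧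
      IntegrableOn (fun s => h s ^ 2) (Set.Ioc 0 T) ∧
      (∀ t ∈ Set.Icc (0:ℝ) T, lam t = ∫ s in (0:ℝ)..t, h s) ∧
      (1/2 : ℝ) * ∫ s in (0:ℝ)..T, (h s) ^ 2 ≤
        Filter.liminf (fun n => (1/2 : ℝ) * ∫ s in (0:ℝ)..T, (hn n s) ^ 2)
          Filter.atTop := by
  set μ := volume.restrict (Ioc 0 T) with hμ
  have hmem (n) : MemLp (hn n) 2 μ :=
    (memLp_two_iff_integrable_sq (hmeas n).aestronglyMeasurable).2 (hL2 n)
  let f (n : ℕ) : Lp ℝ 2 μ := (hmem n).toLp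
  have hf (n) : f n =ᵐ[μ] hn n := (hmem n).coeFn_toLp
  have henergy (n) : ∫ s in (0:ℝ)..T, hn n s ^ 2 = ‖f n‖ ^ 2 := by
    rw [intervalIntegral.integral_of_le hT.le, L2.norm_sq_eq_integral_sq]
    exact integral_congr_ae ((hf n).symm.fun_comp (· ^ 2))
  have hlam (n) {t} (ht : t ∈ Icc 0 T) : lamn n t = ∫ s in (0:ℝ)..t, f n s := by
    rw [hlamn, intervalIntegral.integral_of_le ht.1, intervalIntegral.integral_of_le ht.1]
    exact integral_congr_ae (ae_restrict_of_ae_restrict_of_subset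
      (Ioc_subset_Ioc_right ht.2) (hf n).symm)
  simp only [henergy] at hbound ⊢
  obtain ⟨U, hU, hlim⟩ := exists_ultrafilter_tendsto_liminf
    (u := fun n => (1/2 : ℝ) * ‖f n‖ ^ 2) (a := 0) (fun n => by positivity) hbound
  obtain ⟨g, hg⟩ := U.exists_tendsto_inner (f := f) (r := √(2 * c))
    fun n => Real.le_sqrt_of_sq_le (by linarith [hbound n])
  refine ⟨g, (Lp.stronglyMeasurable g).measurable, (Lp.memLp g).integrable_sq, fun t ht => ?_, ?_⟩
  · have h := hg (indicatorConstLp 2 measurableSet_Ioc (measure_ne_top μ (Ioc 0 t)) 1)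
    simp only [μ, L2.inner_indicatorConstLp_Ioc ht] at h
    exact tendsto_nhds_unique (((hconv.tendsto_at ht).mono_left hU).congr fun n => hlam n ht) h
  · have h := norm_sq_le_of_tendsto_inner (hg g) (by simpa using hlim.const_mul 2)
    rw [intervalIntegral.integral_of_le hT.le, ← hμ, ← L2.norm_sq_eq_integral_sq]
    linarith
end

section
/- For 0 < κ < 8 and w ≥ 0, the improper integral G_κ(w) = ∫_w^∞ (s²+1)^{−4/κ} ds is finite, and the function ε_κ(w) := κ·(w²+1)^{−4/κ}/G_κ(w) − 8w/(w²+1) tends to 0 uniformly in w as κ → 0⁺; that is, sup_{w ≥ 0} |ε_κ(w)| → 0 as κ → 0⁺. -/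
open MeasureTheory Filter Set

/-- The function `s ↦ (s² + 1)^(-p)` is integrable on `ℝ` for `p > 1/2`. -/
theorem integrable_sq_add_one_rpow_neg {p : ℝ} (hp : 1 / 2 < p) :
    Integrable (fun s : ℝ => (s ^ 2 + 1) ^ (-p)) := by
  have h := integrable_rpow_neg_one_add_norm_sq (E := ℝ) (μ := volume) (r := 2 * p)
    (by simp only [Module.finrank_self, Nat.cast_one]; linarith)
  refine h.congr (Eventually.of_forall fun s => ?_)
  simp only [Real.norm_eq_abs, sq_abs]
  rw [add_comm, show -(2 * p) / 2 = -p by ring]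

theorem continuous_sq_add_one_rpow (q : ℝ) :
    Continuous (fun s : ℝ => (s ^ 2 + 1) ^ q) :=
  Continuous.rpow_const (by fun_prop) fun s => Or.inl (by positivity)

theorem hasDerivAt_sq_add_one_rpow (q s : ℝ) :
    HasDerivAt (fun s : ℝ => (s ^ 2 + 1) ^ q) (2 * q * s * (s ^ 2 + 1) ^ (q - 1)) s := by
  have h : HasDerivAt (fun s : ℝ => s ^ 2 + 1) (2 * s) s := by
    simpa using (hasDerivAt_pow 2 s).add_const 1
  convert h.rpow_const (p := q) (Or.inl (by positivity)) using 1
  ring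

theorem tendsto_sq_add_one_rpow_neg {p : ℝ} (hp : 0 < p) :
    Tendsto (fun s : ℝ => (s ^ 2 + 1) ^ (-p)) atTop (nhds 0) :=
  (tendsto_rpow_neg_atTop hp).comp
    (tendsto_atTop_add_const_right _ _ (tendsto_pow_atTop two_ne_zero))

/-- Upper bound for the tail integral of `(s² + 1)^(-p)`. -/
theorem mul_integral_Ioi_sq_add_one_rpow_neg_le {p w : ℝ} (hp : 1 < p) (hw : 0 ≤ w) :
    2 * (p - 1) * w * (∫ s in Ioi w, (s ^ 2 + 1) ^ (-p)) ≤ (w ^ 2 + 1) * (w ^ 2 + 1) ^ (-p) := by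
  have hderiv : ∀ s ∈ Ici w, HasDerivAt (fun s : ℝ => -(s ^ 2 + 1) ^ (-(p - 1)))
      (2 * (p - 1) * s * (s ^ 2 + 1) ^ (-p)) s := fun s _ => by
    refine (hasDerivAt_sq_add_one_rpow (-(p - 1)) s).neg.congr_deriv ?_
    rw [show -(p - 1) - 1 = -p by ring]
    ring
  have hpos : ∀ s ∈ Ioi w, 0 ≤ 2 * (p - 1) * s * (s ^ 2 + 1) ^ (-p) := fun s hs => by
    have h1 : 0 < p - 1 := by linarith
    have h2 : 0 ≤ s := hw.trans (le_of_lt hs)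
    positivity
  have hlim : Tendsto (fun s : ℝ => -(s ^ 2 + 1) ^ (-(p - 1))) atTop (nhds 0) := by
    simpa using (tendsto_sq_add_one_rpow_neg (sub_pos.2 hp)).neg
  have hint := integrableOn_Ioi_deriv_of_nonneg' hderiv hpos hlim
  have heq := integral_Ioi_of_hasDerivAt_of_nonneg' hderiv hpos hlim
  have hpow : (w ^ 2 + 1) * (w ^ 2 + 1) ^ (-p) = (w ^ 2 + 1) ^ (-(p - 1)) := by
    rw [show -(p - 1) = 1 + -p by ring, Real.rpow_add (by positivity), Real.rpow_one]
  rw [hpow, ← integral_const_mul]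
  calc _ ≤ ∫ s in Ioi w, 2 * (p - 1) * s * (s ^ 2 + 1) ^ (-p) := by
        refine setIntegral_mono_on ?_ hint measurableSet_Ioi fun s hs => ?_
        · exact ((integrable_sq_add_one_rpow_neg (by linarith)).integrableOn).const_mul _
        · have h1 : 0 < p - 1 := by linarith
          have h2 : w ≤ s := le_of_lt hs
          gcongr
    _ = _ := by rw [heq]; ring

/-- Lower bound for the tail integral of `(s² + 1)^(-p)`. -/
theorem sq_add_one_rpow_neg_div_le_integral_Ioi {p w : ℝ} (hp : 1 / 2 < p) (hw : 0 ≤ w) :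
    (w ^ 2 + 1) ^ (-p) / (2 * p * w / (w ^ 2 + 1) + √(2 * p)) ≤
      ∫ s in Ioi w, (s ^ 2 + 1) ^ (-p) := by
  have hη : 0 < √(2 * p) := Real.sqrt_pos.2 (by linarith)
  have hη2 : √(2 * p) ^ 2 = 2 * p := Real.sq_sqrt (by linarith)
  set η := √(2 * p)
  have hψ : ∀ s : ℝ, 0 ≤ s → η ≤ 2 * p * s / (s ^ 2 + 1) + η := fun s hs => by
    have : 0 ≤ 2 * p * s / (s ^ 2 + 1) := by positivity
    linarith
  set K : ℝ → ℝ := fun T => (∫ s in w..T, (s ^ 2 + 1) ^ (-p)) +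
    (T ^ 2 + 1) ^ (-p) / (2 * p * T / (T ^ 2 + 1) + η) with hK
  have hlim : Tendsto K atTop (nhds (∫ s in Ioi w, (s ^ 2 + 1) ^ (-p))) := by
    have h1 := intervalIntegral_tendsto_integral_Ioi w
      (integrable_sq_add_one_rpow_neg hp).integrableOn tendsto_id
    have h2 : Tendsto (fun T : ℝ => (T ^ 2 + 1) ^ (-p) / (2 * p * T / (T ^ 2 + 1) + η))
        atTop (nhds 0) := by
      have h3 : Tendsto (fun T : ℝ => (T ^ 2 + 1) ^ (-p) / η) atTop (nhds 0) := by
        simpa using (tendsto_sq_add_one_rpow_neg (p := p) (by linarith)).div_const η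
      refine tendsto_of_tendsto_of_tendsto_of_le_of_le' tendsto_const_nhds h3 ?_ ?_
      · filter_upwards [eventually_ge_atTop 0] with T hT
        have := hη.le.trans (hψ T hT)
        positivity
      · filter_upwards [eventually_ge_atTop 0] with T hT
        have := hψ T hT
        gcongr
    simpa using h1.add h2
  have hderiv : ∀ T : ℝ, 0 ≤ T → ∃ K' : ℝ, 0 ≤ K' ∧ HasDerivAt K K' T := fun T hT => by
    have hc := continuous_sq_add_one_rpow (-p)
    have h1 : HasDerivAt (fun T => ∫ s in w..T, (s ^ 2 + 1) ^ (-p)) ((T ^ 2 + 1) ^ (-p)) T :=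
      intervalIntegral.integral_hasDerivAt_right (hc.intervalIntegrable _ _)
        (hc.stronglyMeasurableAtFilter _ _) hc.continuousAt
    have hsq : HasDerivAt (fun s : ℝ => s ^ 2 + 1) (2 * T) T := by
      simpa using (hasDerivAt_pow 2 T).add_const 1
    have h2 : HasDerivAt (fun T : ℝ => 2 * p * T / (T ^ 2 + 1) + η)
        (2 * p * (1 - T ^ 2) / (T ^ 2 + 1) ^ 2) T := by
      refine ((((hasDerivAt_id T).const_mul (2 * p)).div hsq
        (by positivity)).add_const η).congr_deriv ?_
      simp only [id]
      ring
    have hψT := hψ T hT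
    have h3 := h1.add ((hasDerivAt_sq_add_one_rpow (-p) T).div h2 (hη.trans_le hψT).ne')
    refine ⟨_, ?_, h3⟩
    have hpow : (T ^ 2 + 1) ^ (-p - 1) = (T ^ 2 + 1) ^ (-p) / (T ^ 2 + 1) :=
      Real.rpow_sub_one (by positivity) _
    rw [hpow]
    have hF' : 2 * p * (1 - T ^ 2) / (T ^ 2 + 1) ^ 2 ≤ 2 * p := by
      rw [div_le_iff₀ (by positivity)]
      have : 1 - T ^ 2 ≤ (T ^ 2 + 1) ^ 2 := by nlinarith [sq_nonneg T, sq_nonneg (T ^ 2)]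
      nlinarith
    have hF : 0 ≤ 2 * p * T / (T ^ 2 + 1) := by positivity
    set D := 2 * p * (1 - T ^ 2) / (T ^ 2 + 1) ^ 2
    have hf : 0 ≤ (T ^ 2 + 1) ^ (-p) := by positivity
    set f := (T ^ 2 + 1) ^ (-p)
    have hFe : 2 * -p * T * (f / (T ^ 2 + 1)) = -(2 * p * T / (T ^ 2 + 1)) * f := by ring
    rw [hFe]
    set F := 2 * p * T / (T ^ 2 + 1)
    have hne : F + η ≠ 0 := by linarith
    have : f + (-F * f * (F + η) - f * D) / (F + η) ^ 2
        = f * (η * F + (η ^ 2 - D)) / (F + η) ^ 2 := by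
      field_simp
      ring
    rw [this]
    have : 0 ≤ η ^ 2 - D := by linarith
    positivity
  have hmono : MonotoneOn K (Ici w) := by
    refine monotoneOn_of_deriv_nonneg (convex_Ici w) (fun T hT => ?_) (fun T hT => ?_)
      (fun T hT => ?_)
    · obtain ⟨_, -, h⟩ := hderiv T (hw.trans hT)
      exact h.continuousAt.continuousWithinAt
    · obtain ⟨_, -, h⟩ := hderiv T (hw.trans (interior_subset hT))
      exact h.differentiableAt.differentiableWithinAt
    · obtain ⟨_, h0, h⟩ := hderiv T (hw.trans (interior_subset hT))
      rwa [h.deriv]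
  have hKw : K w = (w ^ 2 + 1) ^ (-p) / (2 * p * w / (w ^ 2 + 1) + η) := by simp [hK]
  rw [← hKw]
  refine ge_of_tendsto hlim ?_
  filter_upwards [eventually_ge_atTop w] with T hT
  exact hmono self_mem_Ici hT hT

/-- For `0 < κ < 8` the integral `G_κ(w) = ∫_w^∞ (s²+1)^{−4/κ} ds` is finite, and
`ε_κ(w) = κ(w²+1)^{−4/κ}/G_κ(w) − 8w/(w²+1)` tends to `0` as `κ → 0⁺`, uniformly in
`w ≥ 0`. -/
theorem eps_kappa_tendsto_zero_uniformly :
    (∀ κ w : ℝ, 0 < κ → κ < 8 → 0 ≤ w →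
      IntegrableOn (fun s : ℝ => (s ^ 2 + 1) ^ (-(4 / κ))) (Set.Ioi w)) ∧
    (∀ ε : ℝ, 0 < ε → ∃ δ : ℝ, 0 < δ ∧ ∀ κ : ℝ, 0 < κ → κ < δ → ∀ w : ℝ, 0 ≤ w →
      |κ * (w ^ 2 + 1) ^ (-(4 / κ)) /
          (∫ s in Set.Ioi w, (s ^ 2 + 1) ^ (-(4 / κ))) -
        8 * w / (w ^ 2 + 1)| < ε) := by
  refine ⟨fun κ w hκ hκ8 _ => (integrable_sq_add_one_rpow_neg ?_).integrableOn,
    fun ε hε => ⟨min 4 (min ε (ε ^ 2 / 8)), by positivity, fun κ hκ hκδ w hw => ?_⟩⟩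
  · rw [lt_div_iff₀ hκ]
    linarith
  obtain ⟨hκ4, hκε, hκε2⟩ : κ < 4 ∧ κ < ε ∧ κ < ε ^ 2 / 8 := by simpa using hκδ
  have hp : 1 < 4 / κ := by rwa [one_lt_div hκ]
  have hup := sq_add_one_rpow_neg_div_le_integral_Ioi (p := 4 / κ) (by linarith) hw
  have hlow := mul_integral_Ioi_sq_add_one_rpow_neg_le hp hw
  have hη : 0 < √(2 * (4 / κ)) := by positivity
  have hκη : κ * √(2 * (4 / κ)) < ε := by
    refine lt_of_pow_lt_pow_left₀ 2 hε.le ?_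
    rw [mul_pow, Real.sq_sqrt (by positivity)]
    field_simp
    linarith
  have hf : 0 < (w ^ 2 + 1) ^ (-(4 / κ)) := by positivity
  set G := ∫ s in Ioi w, (s ^ 2 + 1) ^ (-(4 / κ))
  set f := (w ^ 2 + 1) ^ (-(4 / κ))
  set η := √(2 * (4 / κ))
  have hψ : 0 < 2 * (4 / κ) * w / (w ^ 2 + 1) + η := by positivity
  have hG : 0 < G := (div_pos hf hψ).trans_le hup
  rw [div_le_iff₀ hψ] at hup
  have hupper : κ * f / G ≤ 8 * w / (w ^ 2 + 1) + κ * η := by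
    rw [div_le_iff₀ hG]
    calc κ * f ≤ κ * (G * (2 * (4 / κ) * w / (w ^ 2 + 1) + η)) := by gcongr
      _ = _ := by field_simp; ring
  have hlower : 8 * w / (w ^ 2 + 1) - κ ≤ κ * f / G := by
    have h1 : (8 - 2 * κ) * w / (w ^ 2 + 1) ≤ κ * f / G := by
      rw [div_le_div_iff₀ (by positivity) hG]
      calc (8 - 2 * κ) * w * G = κ * (2 * (4 / κ - 1) * w * G) := by field_simp; ring
        _ ≤ κ * ((w ^ 2 + 1) * f) := by gcongr
        _ = _ := by ring
    have h2 : 2 * w / (w ^ 2 + 1) ≤ 1 := by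
      rw [div_le_one (by positivity)]
      nlinarith [sq_nonneg (w - 1)]
    have h3 : (8 - 2 * κ) * w / (w ^ 2 + 1) =
        8 * w / (w ^ 2 + 1) - κ * (2 * w / (w ^ 2 + 1)) := by ring
    nlinarith
  rw [abs_lt]
  constructor <;> linarith
end

section
/- (Openness of the strict one-point left/right passage event.) Let z₀ ∈ ℂ with Im z₀ > 0 and let T > 0. Consider the set O of continuous functions λ : [0,T] → ℝ such that there exists g : [0,T] → ℂ with g(0) = z₀, and for every t ∈ [0,T], g(t) ≠ λ(t) and g is differentiable at t with g′(t) = 2/(g(t) − λ(t)), and Re(g(T) − λ(T)) > 0. Then O is an open subset of C([0,T], ℝ) equipped with the supremum norm. -/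
open MeasureTheory Filter Set

open scoped NNReal Topology

/-- A bounded Lipschitz real function on a set extends to a bounded Lipschitz function. -/
lemma LipschitzOnWith.exists_extend_abs_le {α : Type*} [PseudoMetricSpace α] {h : α → ℝ}
    {s : Set α} {K : ℝ≥0} {M : ℝ} (hh : LipschitzOnWith K h s) (hM : 0 ≤ M)
    (hb : ∀ x ∈ s, |h x| ≤ M) :
    ∃ k : α → ℝ, LipschitzWith K k ∧ EqOn h k s ∧ ∀ x, |k x| ≤ M := by
  obtain ⟨k, hk, hks⟩ := hh.extend_real
  refine ⟨fun x => max (-M) (min M (k x)), (hk.const_min M).const_max (-M), fun x hx => ?_,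
    fun x => abs_le.2 ⟨le_max_left _ _, max_le (by linarith) (min_le_left _ _)⟩⟩
  have := abs_le.1 (hb x hx)
  have hxk := hks hx
  simp only
  rw [← hxk, min_eq_right this.2, max_eq_right this.1]

/-- Away from the origin, `u ↦ 2 / u` agrees with a globally bounded Lipschitz field. -/
lemma exists_lipschitzWith_bounded_eq_two_div {δ : ℝ} (hδ : 0 < δ) :
    ∃ (φ : ℂ → ℂ) (K M : ℝ≥0), LipschitzWith K φ ∧ (∀ u, ‖φ u‖ ≤ M) ∧
      ∀ u, δ ≤ ‖u‖ → φ u = 2 / u := by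
  have hlip : LipschitzOnWith (2 / δ ^ 2).toNNReal (fun u : ℂ => 2 / u) {u | δ ≤ ‖u‖} := by
    refine LipschitzOnWith.of_dist_le_mul fun u hu v hv => ?_
    simp only [mem_ofPred_eq] at hu hv
    have hu0 : u ≠ 0 := norm_pos_iff.1 (hδ.trans_le hu)
    have hv0 : v ≠ 0 := norm_pos_iff.1 (hδ.trans_le hv)
    rw [Real.coe_toNNReal _ (by positivity), dist_eq_norm, dist_eq_norm,
      show 2 / u - 2 / v = 2 / (u * v) * (v - u) by field_simp, norm_mul, norm_sub_rev v u,
      norm_div, norm_mul, Complex.norm_ofNat, sq]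
    gcongr
  have hbd : ∀ u ∈ {u : ℂ | δ ≤ ‖u‖}, ‖2 / u‖ ≤ 2 / δ := fun u hu => by
    rw [norm_div, Complex.norm_ofNat]
    exact div_le_div_of_nonneg_left (by norm_num) hδ hu
  have hre := LipschitzOnWith.exists_extend_abs_le (h := fun u : ℂ => (2 / u).re) (M := 2 / δ)
    (LipschitzOnWith.of_dist_le_mul fun u hu v hv => le_trans
      (by rw [Real.dist_eq, ← Complex.sub_re, dist_eq_norm]; exact Complex.abs_re_le_norm _)
      (hlip.dist_le_mul u hu v hv)) (by positivity)
    fun u hu => (Complex.abs_re_le_norm _).trans (hbd u hu)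
  have him := LipschitzOnWith.exists_extend_abs_le (h := fun u : ℂ => (2 / u).im) (M := 2 / δ)
    (LipschitzOnWith.of_dist_le_mul fun u hu v hv => le_trans
      (by rw [Real.dist_eq, ← Complex.sub_im, dist_eq_norm]; exact Complex.abs_im_le_norm _)
      (hlip.dist_le_mul u hu v hv)) (by positivity)
    fun u hu => (Complex.abs_im_le_norm _).trans (hbd u hu)
  obtain ⟨a, ha, haeq, hab⟩ := hre
  obtain ⟨b, hb, hbeq, hbb⟩ := him
  refine ⟨fun u => ⟨a u, b u⟩, _, (2 / δ + 2 / δ).toNNReal,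
    LipschitzWith.of_dist_le_mul (K := (2 / δ ^ 2).toNNReal + (2 / δ ^ 2).toNNReal)
      fun u v => ?_, fun u => ?_, fun u hu => ?_⟩
  · have h1 := ha.dist_le_mul u v
    have h2 := hb.dist_le_mul u v
    rw [Real.dist_eq] at h1 h2
    rw [dist_eq_norm (Complex.mk _ _), NNReal.coe_add, add_mul]
    exact (Complex.norm_le_abs_re_add_abs_im _).trans (add_le_add h1 h2)
  · rw [Real.coe_toNNReal _ (by positivity)]
    exact (Complex.norm_le_abs_re_add_abs_im _).trans (add_le_add (hab u) (hbb u))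
  · exact Complex.ext (haeq hu).symm (hbeq hu).symm

lemma LipschitzWith.comp_sub_const {φ : ℂ → ℂ} {K : ℝ≥0} (hφ : LipschitzWith K φ) (a : ℂ) :
    LipschitzWith K fun w => φ (w - a) :=
  LipschitzWith.of_dist_le_mul fun u v => (hφ.dist_le_mul _ _).trans_eq (by rw [dist_sub_right])

/-- Global existence for the flow of a bounded Lipschitz field translated by a continuous
driving function. -/
lemma exists_hasDerivWithinAt_translated_field {φ : ℂ → ℂ} {K M : ℝ≥0} (hφ : LipschitzWith K φ)
    (hM : ∀ u, ‖φ u‖ ≤ M) {F : ℝ → ℂ} (hF : Continuous F) (z : ℂ) {T : ℝ} (hT : 0 ≤ T) :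
    ∃ g : ℝ → ℂ, g 0 = z ∧
      ∀ t ∈ Icc 0 T, HasDerivWithinAt g (φ (g t - F t)) (Icc 0 T) t := by
  have hPL : IsPicardLindelof (fun t w => φ (w - F t)) (⟨0, left_mem_Icc.2 hT⟩ : Icc 0 T) z
      (M * T.toNNReal) 0 M K :=
    { lipschitzOnWith := fun t _ => (hφ.comp_sub_const (F t)).lipschitzOnWith
      continuousOn := fun x _ => (hφ.continuous.comp (continuous_const.sub hF)).continuousOn
      norm_le := fun t _ x _ => hM _
      mul_max_le := by simp [hT] }
  exact hPL.exists_eq_forall_mem_Icc_hasDerivWithinAt₀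

/-- Continuous dependence of the translated flow on its driving function. -/
lemma dist_translated_flow_le {φ : ℂ → ℂ} {K : ℝ≥0} (hφ : LipschitzWith K φ) {F G : ℝ → ℂ}
    {T ε : ℝ} (hε : 0 ≤ ε) (hFG : ∀ t ∈ Icc 0 T, dist (F t) (G t) ≤ ε) {g h : ℝ → ℂ}
    (h0 : g 0 = h 0) (hg : ∀ t ∈ Icc 0 T, HasDerivWithinAt g (φ (g t - F t)) (Icc 0 T) t)
    (hh : ∀ t ∈ Icc 0 T, HasDerivWithinAt h (φ (h t - G t)) (Icc 0 T) t)
    {t : ℝ} (ht : t ∈ Icc 0 T) : dist (g t) (h t) ≤ gronwallBound 0 K (K * ε) T := by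
  have hright : ∀ {k : ℝ → ℂ} {k' : ℂ} {s : ℝ}, s ∈ Ico 0 T →
      HasDerivWithinAt k k' (Icc 0 T) s → HasDerivWithinAt k k' (Ici s) s := fun hs hk =>
    hk.mono_of_mem_nhdsWithin (Icc_mem_nhdsGE_of_mem hs)
  have key := dist_le_of_approx_trajectories_ODE (v := fun t w => φ (w - F t)) (K := K)
    (f := g) (g := h) (f' := fun t => φ (g t - F t)) (g' := fun t => φ (h t - G t))
    (a := 0) (b := T) (εf := 0) (εg := K * ε) (δ := 0)
    (fun t => hφ.comp_sub_const (F t))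
    (fun s hs => (hg s hs).continuousWithinAt)
    (fun s hs => hright hs (hg s (Ico_subset_Icc_self hs))) (fun s _ => by simp)
    (fun s hs => (hh s hs).continuousWithinAt)
    (fun s hs => hright hs (hh s (Ico_subset_Icc_self hs)))
    (fun s hs => (hφ.dist_le_mul _ _).trans (by
      have := hFG s (Ico_subset_Icc_self hs)
      rw [dist_sub_left, dist_comm]
      gcongr)) (by simp [h0]) t ht
  rw [zero_add, sub_zero] at key
  exact key.trans (gronwallBound_mono le_rfl (by positivity) K.2 ht.2)

/-- Openness of the strict one-point right-passage event: the set of continuous driving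
functions `λ : [0,T] → ℝ` whose Loewner flow of `z₀` survives up to time `T` and ends
with `Re(g(T) − λ(T)) > 0` is open in `C([0,T], ℝ)` for the supremum norm. -/
theorem strict_passage_event_isOpen (z₀ : ℂ) (hz₀ : 0 < z₀.im) (T : ℝ) (hT : 0 < T) :
    IsOpen {f : C(Set.Icc (0:ℝ) T, ℝ) |
      ∃ g : ℝ → ℂ, g 0 = z₀ ∧
        (∀ t : Set.Icc (0:ℝ) T, g t ≠ (f t : ℂ) ∧
          HasDerivWithinAt g (2 / (g t - (f t : ℂ))) (Set.Icc 0 T) (t : ℝ)) ∧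
        0 < (g T - ((f ⟨T, Set.right_mem_Icc.mpr hT.le⟩ : ℝ) : ℂ)).re} := by
  rw [Metric.isOpen_iff]
  rintro f ⟨g, hg0, hg, hgT⟩
  have ext_cont : ∀ f : C(Icc (0 : ℝ) T, ℝ),
      Continuous fun t => ((IccExtend hT.le f t : ℝ) : ℂ) := fun f =>
    Complex.continuous_ofReal.comp f.continuous.Icc_extend'
  have ext_apply : ∀ (f : C(Icc (0 : ℝ) T, ℝ)) (t : ℝ) (ht : t ∈ Icc 0 T),
      IccExtend hT.le f t = f ⟨t, ht⟩ := fun f t ht => IccExtend_of_mem _ _ ht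
  obtain ⟨δ, hδ, hgap⟩ : ∃ δ > 0, ∀ t : Icc (0 : ℝ) T, 3 * δ ≤ ‖g t - (f t : ℂ)‖ := by
    have hcont : ContinuousOn (fun t => ‖g t - ((IccExtend hT.le f t : ℝ) : ℂ)‖) (Icc 0 T) :=
      ContinuousOn.norm <| ContinuousOn.sub
        (fun t ht => (hg ⟨t, ht⟩).2.continuousWithinAt) (ext_cont f).continuousOn
    obtain ⟨s, hs, hmin⟩ := isCompact_Icc.exists_isMinOn (nonempty_Icc.2 hT.le) hcont
    refine ⟨‖g s - (f ⟨s, hs⟩ : ℂ)‖ / 3,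
      div_pos (norm_pos_iff.2 (sub_ne_zero.2 (hg ⟨s, hs⟩).1)) three_pos, fun t => ?_⟩
    have := hmin t.2
    simp only [mem_ofPred_eq, ext_apply f s hs, ext_apply f t t.2] at this
    linarith
  obtain ⟨φ, K, M, hφ, hM, hφeq⟩ := exists_lipschitzWith_bounded_eq_two_div hδ
  set c := (g T - ((f ⟨T, right_mem_Icc.mpr hT.le⟩ : ℝ) : ℂ)).re with hc
  have hη : 0 < min δ (c / 2) := lt_min hδ (half_pos hgT)
  obtain ⟨ε, hε, hεη, hεK⟩ : ∃ ε > 0, ε < min δ (c / 2) ∧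
      gronwallBound 0 K (K * ε) T < min δ (c / 2) := by
    have hlim : Tendsto (fun ε : ℝ => gronwallBound 0 K (K * ε) T) (𝓝[>] 0) (𝓝 0) := by
      have : Continuous fun ε : ℝ => gronwallBound 0 K (K * ε) T :=
        (gronwallBound_continuous_ε 0 K T).comp (continuous_const.mul continuous_id)
      have h := this.tendsto 0
      rw [mul_zero, gronwallBound_ε0_δ0] at h
      exact h.mono_left nhdsWithin_le_nhds
    obtain ⟨ε, h1, h2⟩ := ((hlim.eventually_lt_const hη).and (Ioo_mem_nhdsGT hη)).exists
    exact ⟨ε, h2.1, h2.2, h1⟩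
  refine ⟨ε, hε, fun f₁ hf₁ => ?_⟩
  have hff : ∀ t, dist (f t : ℂ) (f₁ t : ℂ) ≤ ε := fun t => by
    rw [Complex.dist_of_im_eq (by simp), dist_comm]
    exact (ContinuousMap.dist_apply_le_dist t).trans (Metric.mem_ball.1 hf₁).le
  obtain ⟨h, hh0, hh⟩ := exists_hasDerivWithinAt_translated_field hφ hM (ext_cont f₁) z₀ hT.le
  have hclose : ∀ t : Icc (0 : ℝ) T, dist (g t) (h t) < min δ (c / 2) := fun t => by
    refine (dist_translated_flow_le hφ hε.le (F := fun t => ((IccExtend hT.le f t : ℝ) : ℂ))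
      (fun t ht => ?_) (hg0.trans hh0.symm) (fun t ht => ?_) hh t.2).trans_lt hεK
    · simpa only [ext_apply _ t ht] using hff ⟨t, ht⟩
    · have := hgap ⟨t, ht⟩
      rw [ext_apply f t ht, hφeq _ (by linarith)]
      exact (hg ⟨t, ht⟩).2
  have hdiff : ∀ t : Icc (0 : ℝ) T,
      ‖(g t - (f t : ℂ)) - (h t - (f₁ t : ℂ))‖ < 2 * min δ (c / 2) := fun t => by
    rw [← dist_eq_norm]
    linarith [dist_sub_sub_le (g t) (f t : ℂ) (h t) (f₁ t : ℂ), hclose t, hff t]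
  have hfar : ∀ t : Icc (0 : ℝ) T, δ ≤ ‖h t - (f₁ t : ℂ)‖ := fun t => by
    linarith [norm_sub_norm_le (g t - (f t : ℂ)) (h t - (f₁ t : ℂ)), hdiff t, hgap t,
      min_le_left δ (c / 2)]
  refine ⟨h, hh0, fun t => ⟨fun heq => ?_, ?_⟩, ?_⟩
  · have := hfar t
    rw [heq, sub_self, norm_zero] at this
    linarith
  · have := hh t t.2
    rwa [ext_apply f₁ t t.2, hφeq _ (hfar t)] at this
  · have h1 := (Complex.re_le_norm _).trans_lt (hdiff ⟨T, right_mem_Icc.mpr hT.le⟩)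
    rw [Complex.sub_re, ← hc] at h1
    linarith [min_le_right δ (c / 2)]
end
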